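/- Let m be analytic on the open unit disc 𝔻 and not identically zero, let b and d be the analytic functions on 𝔻 determined by b(λ²) = m(λ) + m(−λ) and λ·d(λ²) = m(λ) − m(−λ) for all λ ∈ 𝔻, and set Θ(λ) = (1/2)·[[b(λ), λ·d(λ)], [d(λ), b(λ)]]. Then there exist rank-one orthogonal projections Q₁, Q₂ on ℂ² satisfying Θ(λ)Q₂ = Q₁Θ(λ) for all λ ∈ 𝔻 if and only if either (i) m(λ) = m(−λ) for all λ ∈ 𝔻, or (ii) there exist μ ∈ 𝔻 and a function p analytic on 𝔻 with p(λ) = p(−λ) for all λ ∈ 𝔻 such that m(λ) = p(λ)·(λ + μ)/(1 + conj(μ)·λ) for all λ ∈ 𝔻. -/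

import Mathlib

open Metric

/-- `Q` is a rank-one orthogonal projection on `ℂ²`. -/
def IsRankOneProj (Q : Matrix (Fin 2) (Fin 2) ℂ) : Prop :=
  Q.conjTranspose = Q ∧ Q * Q = Q ∧ Q.rank = 1

theorem idem_trace_rank (Q : Matrix (Fin 2) (Fin 2) ℂ) (h : Q * Q = Q) :
    Q.trace = (Q.rank : ℂ) := by
  have hi : IsIdempotentElem (Matrix.toLin' Q) := by
    unfold IsIdempotentElem
    rw [Module.End.mul_eq_comp, ← Matrix.toLin'_mul, h]
  have := (LinearMap.IsIdempotentElem.isProj_range _ hi).trace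
  rw [LinearMap.trace_eq_matrix_trace ℂ (Pi.basisFun ℂ (Fin 2))] at this
  rw [← Matrix.toLin_eq_toLin', LinearMap.toMatrix_toLin] at this
  rw [this]
  rfl

theorem proj_mk (a e : ℝ) (c : ℂ) (h1 : a + e = 1)
    (h2 : (a : ℂ) * e = c * (starRingEnd ℂ) c) :
    IsRankOneProj !![(a : ℂ), c; (starRingEnd ℂ) c, (e : ℂ)] := by
  have h1' : (a : ℂ) + e = 1 := by exact_mod_cast h1
  have hQ : !![(a : ℂ), c; (starRingEnd ℂ) c, (e : ℂ)] * !![(a : ℂ), c; (starRingEnd ℂ) c, (e : ℂ)]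
      = !![(a : ℂ), c; (starRingEnd ℂ) c, (e : ℂ)] := by
    ext i j
    fin_cases i <;> fin_cases j <;> simp [Matrix.mul_apply, Fin.sum_univ_two] 
    · linear_combination (a : ℂ) * h1' - h2
    · linear_combination c * h1'
    · linear_combination (starRingEnd ℂ) c * h1'
    · linear_combination (e : ℂ) * h1' - h2
  refine ⟨?_, hQ, ?_⟩
  · ext i j
    fin_cases i <;> fin_cases j <;> simp [Matrix.conjTranspose_apply]
  · have := idem_trace_rank _ hQ
    simp [Matrix.trace, Fin.sum_univ_two, h1'] at this
    exact_mod_cast this.symm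

theorem proj_elim (Q : Matrix (Fin 2) (Fin 2) ℂ) (h : IsRankOneProj Q) :
    ∃ (a e : ℝ) (c : ℂ), a + e = 1 ∧ (a : ℂ) * e = c * (starRingEnd ℂ) c ∧
      Q = !![(a : ℂ), c; (starRingEnd ℂ) c, (e : ℂ)] := by
  obtain ⟨hs, hi, hr⟩ := h
  have ht := idem_trace_rank _ hi
  rw [hr, Matrix.trace, Fin.sum_univ_two] at ht
  simp at ht
  have h00 := congrFun (congrFun hs 0) 0
  have h10 := congrFun (congrFun hs 1) 0
  have h11 := congrFun (congrFun hs 1) 1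
  simp only [Matrix.conjTranspose_apply] at h00 h10 h11
  obtain ⟨a, ha⟩ := Complex.conj_eq_iff_real.1 h00
  obtain ⟨e, he⟩ := Complex.conj_eq_iff_real.1 h11
  have i00 := congrFun (congrFun hi 0) 0
  simp only [Matrix.mul_apply, Fin.sum_univ_two] at i00
  rw [← h10, ha] at i00
  rw [ha, he] at ht
  refine ⟨a, e, Q 0 1, by exact_mod_cast ht, ?_, ?_⟩
  · change (a:ℂ) * a + Q 0 1 * (starRingEnd ℂ) (Q 0 1) = a at i00
    linear_combination (a:ℂ) * ht - i00
  · ext i j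
    fin_cases i <;> fin_cases j <;> simp [ha, he]
    exact h10.symm

/-- The four scalar equations. -/
theorem eqs_iff (B D z a1 c1 f1 e1 a2 c2 f2 e2 : ℂ) :
    (((1 / 2 : ℂ) • !![B, z * D; D, B]) * !![a2, c2; f2, e2] =
      !![a1, c1; f1, e1] * ((1 / 2 : ℂ) • !![B, z * D; D, B])) ↔
    (B * a2 + z * D * f2 = a1 * B + c1 * D ∧ B * c2 + z * D * e2 = a1 * (z * D) + c1 * B ∧
     D * a2 + B * f2 = f1 * B + e1 * D ∧ D * c2 + B * e2 = f1 * (z * D) + e1 * B) := by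
  rw [Matrix.smul_mul, Matrix.mul_smul, smul_right_inj (by norm_num : (1 / 2 : ℂ) ≠ 0)]
  rw [← Matrix.ext_iff]
  simp [Fin.forall_fin_two, Matrix.mul_apply, Fin.sum_univ_two, and_assoc]

theorem zero_of_punctured (F : ℂ → ℂ) (hF : DifferentiableOn ℂ F (ball (0 : ℂ) 1))
    (h : ∀ z ∈ ball (0 : ℂ) 1, z ≠ 0 → F z = 0) : ∀ z ∈ ball (0 : ℂ) 1, F z = 0 := by
  intro z hz
  by_cases h0 : z = 0
  · subst h0
    have hc : ContinuousAt F 0 :=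
      (hF.differentiableAt (isOpen_ball.mem_nhds hz)).continuousAt
    have h1 : Filter.Tendsto F (nhdsWithin 0 {0}ᶜ) (nhds (F 0)) := hc.mono_left nhdsWithin_le_nhds
    have h2 : Filter.Tendsto F (nhdsWithin 0 {0}ᶜ) (nhds 0) := by
      refine tendsto_const_nhds.congr' ?_
      filter_upwards [self_mem_nhdsWithin, nhdsWithin_le_nhds (isOpen_ball.mem_nhds hz)] with w hw hw'
      exact (h w hw' hw).symm
    exact tendsto_nhds_unique h1 h2
  · exact h z hz h0

theorem exists_sqrt (w : ℂ) (hw : w ∈ ball (0 : ℂ) 1) (h0 : w ≠ 0) :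
    ∃ z ∈ ball (0 : ℂ) 1, z ≠ 0 ∧ z ^ 2 = w := by
  obtain ⟨z, hz⟩ := IsAlgClosed.exists_pow_nat_eq w (n := 2) (by norm_num)
  refine ⟨z, ?_, ?_, hz⟩
  · rw [mem_ball_zero_iff] at *
    rw [← hz, norm_pow] at hw
    nlinarith [norm_nonneg z]
  · rintro rfl
    apply h0
    rw [← hz]; norm_num

theorem one_add_ne (μ z : ℂ) (hμ : μ ∈ ball (0 : ℂ) 1) (hz : z ∈ ball (0 : ℂ) 1) :
    1 + (starRingEnd ℂ) μ * z ≠ 0 := by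
  intro h
  rw [mem_ball_zero_iff] at *
  have h2 : (starRingEnd ℂ) μ * z = -1 := by linear_combination h
  have h3 := congrArg norm h2
  rw [norm_mul, Complex.norm_conj, norm_neg, norm_one] at h3
  nlinarith [norm_nonneg μ, norm_nonneg z]

theorem sq_mem (z : ℂ) (hz : z ∈ ball (0 : ℂ) 1) : z ^ 2 ∈ ball (0 : ℂ) 1 := by
  rw [mem_ball_zero_iff] at *
  rw [norm_pow]
  nlinarith [norm_nonneg z]

/-- If an affine function annihilates `d ≢ 0`, it is zero. -/
theorem affine_zero (d : ℂ → ℂ) (hd : DifferentiableOn ℂ d (ball (0 : ℂ) 1))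
    (hne : ∃ z ∈ ball (0 : ℂ) 1, d z ≠ 0) (u v : ℂ)
    (h : ∀ z ∈ ball (0 : ℂ) 1, d z * (u + z * v) = 0) : u = 0 ∧ v = 0 := by
  obtain ⟨w, hw, hdw⟩ := hne
  have hc : ContinuousAt d w :=
    (hd.differentiableAt (isOpen_ball.mem_nhds hw)).continuousAt
  have hev : ∀ᶠ z in nhds w, u + z * v = 0 := by
    filter_upwards [hc.eventually_ne hdw, isOpen_ball.mem_nhds hw] with z h1 h2
    exact (mul_eq_zero.1 (h z h2)).resolve_left h1
  have hw0 := hev.self_of_nhds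
  have hp : ∃ z, u + z * v = 0 ∧ z ≠ w := by
    have : ∀ᶠ z in nhdsWithin w {w}ᶜ, u + z * v = 0 ∧ z ≠ w := by
      filter_upwards [self_mem_nhdsWithin, nhdsWithin_le_nhds hev] with z h1 h2
      exact ⟨h2, h1⟩
    exact this.exists
  obtain ⟨z, hz, hzw⟩ := hp
  have hv : v = 0 := by
    have : (z - w) * v = 0 := by linear_combination hz - hw0
    exact (mul_eq_zero.1 this).resolve_left (sub_ne_zero.2 hzw)
  subst hv
  exact ⟨by simpa using hw0, rfl⟩

/-- Construction of the factorization from `k`, `μ`. -/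
theorem mk_factor (m b d : ℂ → ℂ)
    (hd : DifferentiableOn ℂ d (ball (0 : ℂ) 1))
    (hbm : ∀ z ∈ ball (0 : ℂ) 1, b (z ^ 2) = m z + m (-z))
    (hdm : ∀ z ∈ ball (0 : ℂ) 1, z * d (z ^ 2) = m z - m (-z))
    (s c k μ : ℂ) (hs : s ≠ 0) (hμ : μ ∈ ball (0 : ℂ) 1)
    (hbs : ∀ z ∈ ball (0 : ℂ) 1, b z * s = d z * (c - z * (starRingEnd ℂ) c))
    (h1 : k * μ = c) (h2 : k * (starRingEnd ℂ) μ = (starRingEnd ℂ) c)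
    (h3 : k * (1 - μ * (starRingEnd ℂ) μ) = s) :
    (∃ μ ∈ ball (0 : ℂ) 1, ∃ p : ℂ → ℂ,
       DifferentiableOn ℂ p (ball (0 : ℂ) 1) ∧
       (∀ z ∈ ball (0 : ℂ) 1, p z = p (-z)) ∧
       ∀ z ∈ ball (0 : ℂ) 1,
         m z = p z * (z + μ) / (1 + (starRingEnd ℂ) μ * z)) := by
  refine ⟨μ, hμ, fun z => d (z ^ 2) * (k / (2 * s) * (1 - (starRingEnd ℂ) μ ^ 2 * z ^ 2)), ?_, ?_, ?_⟩
  · refine DifferentiableOn.mul ?_ (by fun_prop)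
    exact hd.comp (by fun_prop) (fun z hz => sq_mem z hz)
  · intro z _
    simp
  · intro z hz
    have hn := one_add_ne μ z hμ hz
    rw [eq_div_iff hn]
    have e1 := hbm z hz
    have e2 := hdm z hz
    have e3 := hbs _ (sq_mem z hz)
    have e4 : 2 * s * m z = d (z ^ 2) * (k * (z + μ) * (1 - (starRingEnd ℂ) μ * z)) := by
      rw [← h1] at e3 
      rw [map_mul] at e3
      rw [← h1, map_mul] at h2
      linear_combination -s * e1 - s * e2 + e3 + d (z^2) * z^2 * h2 - d (z^2) * z * h3
    have e5 : m z = d (z ^ 2) * (k * (z + μ) * (1 - (starRingEnd ℂ) μ * z)) / (2 * s) := by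
      rw [← e4]; field_simp
    rw [e5]
    field_simp
    ring

/-- Theorem 1: the characteristic function `Θ` of `T²` admits intertwining rank-one
projections iff `m` is even, or `m(λ) = p(λ)·(λ+μ)/(1+conj(μ)λ)` with `p` even analytic
and `μ` in the disc. -/
theorem theorem1_reducibility
    (m b d : ℂ → ℂ)
    (hm : DifferentiableOn ℂ m (ball (0 : ℂ) 1))
    (hmne : ∃ z ∈ ball (0 : ℂ) 1, m z ≠ 0)
    (hb : DifferentiableOn ℂ b (ball (0 : ℂ) 1))
    (hd : DifferentiableOn ℂ d (ball (0 : ℂ) 1))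
    (hbm : ∀ z ∈ ball (0 : ℂ) 1, b (z ^ 2) = m z + m (-z))
    (hdm : ∀ z ∈ ball (0 : ℂ) 1, z * d (z ^ 2) = m z - m (-z)) :
    (∃ Q₁ Q₂ : Matrix (Fin 2) (Fin 2) ℂ, IsRankOneProj Q₁ ∧ IsRankOneProj Q₂ ∧
      ∀ z ∈ ball (0 : ℂ) 1,
        ((1 / 2 : ℂ) • !![b z, z * d z; d z, b z]) * Q₂ =
          Q₁ * ((1 / 2 : ℂ) • !![b z, z * d z; d z, b z])) ↔
    ((∀ z ∈ ball (0 : ℂ) 1, m z = m (-z)) ∨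
     (∃ μ ∈ ball (0 : ℂ) 1, ∃ p : ℂ → ℂ,
       DifferentiableOn ℂ p (ball (0 : ℂ) 1) ∧
       (∀ z ∈ ball (0 : ℂ) 1, p z = p (-z)) ∧
       ∀ z ∈ ball (0 : ℂ) 1,
         m z = p z * (z + μ) / (1 + (starRingEnd ℂ) μ * z))) := by
  constructor
  · rintro ⟨Q₁, Q₂, hQ1, hQ2, h⟩
    by_cases hne : ∃ z ∈ ball (0 : ℂ) 1, d z ≠ 0
    · right
      obtain ⟨a1, e1, c1, hs1, hp1, rfl⟩ := proj_elim _ hQ1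
      obtain ⟨a2, e2, c2, hs2, hp2, rfl⟩ := proj_elim _ hQ2
      simp only [eqs_iff] at h
      obtain rfl : e1 = 1 - a1 := by linarith
      obtain rfl : e2 = 1 - a2 := by linarith
      push_cast at *
      obtain ⟨hu, -⟩ := affine_zero d hd hne (c2 - c1)
        ((starRingEnd ℂ) c2 - (starRingEnd ℂ) c1) (fun z hz => by
          obtain ⟨q1, -, -, q4⟩ := h z hz
          linear_combination q1 + q4)
      obtain rfl : c2 = c1 := by linear_combination hu
      obtain ⟨ht, -⟩ := affine_zero d hd hne (a1 + a2 - 1 : ℂ) 0 (fun z hz => by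
          obtain ⟨-, -, q3, -⟩ := h z hz
          linear_combination q3)
      have ht' : a1 + a2 - 1 = 0 := by exact_mod_cast ht
      obtain rfl : a2 = 1 - a1 := by linarith
      push_cast at *
      have hbs : ∀ z ∈ ball (0 : ℂ) 1, b z * (1 - 2 * a1 : ℂ) =
          d z * (c2 - z * (starRingEnd ℂ) c2) := fun z hz => by
        obtain ⟨q1, -, -, -⟩ := h z hz
        linear_combination q1
      have hnn : a1 * (1 - a1) = Complex.normSq c2 := by
        rw [Complex.mul_conj] at hp1
        exact_mod_cast hp1
      have hnn' : a1 * (1 - a1) = ‖c2‖ ^ 2 := by rw [hnn, Complex.normSq_eq_norm_sq]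
      have hs0 : a1 ≠ 1 / 2 := by
        rintro rfl
        obtain ⟨hc, -⟩ := affine_zero d hd hne c2 (-(starRingEnd ℂ) c2) (fun z hz => by
          have := hbs z hz
          push_cast at this
          linear_combination -this)
        subst hc
        norm_num at hnn
      have hs : (1 - 2 * a1 : ℂ) ≠ 0 := by
        intro h0
        have : 1 - 2 * a1 = 0 := by exact_mod_cast h0
        apply hs0; linarith
      rcases lt_or_gt_of_ne hs0 with hlt | hgt
      · have hk : (1 - a1 : ℂ) ≠ 0 := by
          intro h0
          have : 1 - a1 = 0 := by exact_mod_cast h0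
          linarith
        refine mk_factor m b d hd hbm hdm (1 - 2 * a1) c2 (1 - a1) (c2 / (1 - a1)) hs ?_ hbs ?_ ?_ ?_
        · rw [mem_ball_zero_iff, norm_div]
          have : ‖(1 - a1 : ℂ)‖ = 1 - a1 := by
            rw [← Complex.ofReal_one, ← Complex.ofReal_sub, Complex.norm_real, Real.norm_eq_abs,
              abs_of_pos (by linarith)]
          rw [this, div_lt_one (by linarith)]
          nlinarith [norm_nonneg c2]
        · field_simp
        · simp; field_simp
        · simp only [map_div₀, map_sub, map_one, Complex.conj_ofReal]
          field_simp
          linear_combination hp1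
      · have hk : (a1 : ℂ) ≠ 0 := by
          intro h0
          have : a1 = 0 := by exact_mod_cast h0
          linarith
        refine mk_factor m b d hd hbm hdm (1 - 2 * a1) c2 (-a1) (-c2 / a1) hs ?_ hbs ?_ ?_ ?_
        · rw [mem_ball_zero_iff, norm_div, norm_neg, Complex.norm_real, Real.norm_eq_abs,
              abs_of_pos (by linarith), div_lt_one (by linarith)]
          nlinarith [norm_nonneg c2]
        · field_simp
        · simp; field_simp
        · simp only [map_div₀, map_neg, Complex.conj_ofReal]
          field_simp
          linear_combination -hp1
    · left
      push Not at hne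
      intro z hz
      have := hdm z hz
      rw [hne _ (sq_mem z hz)] at this
      linear_combination -this
  · rintro (he | ⟨μ, hμ, p, hp, hpe, hmp⟩)
    · have hd0 : ∀ z ∈ ball (0 : ℂ) 1, d z = 0 := by
        refine zero_of_punctured d hd fun w hw hw0 => ?_
        obtain ⟨z, hz, hz0, rfl⟩ := exists_sqrt w hw hw0
        have := hdm z hz
        rw [← he z hz, sub_self] at this
        exact (mul_eq_zero.1 this).resolve_left hz0
      refine ⟨_, _, proj_mk 1 0 0 (by norm_num) (by norm_num),
        proj_mk 1 0 0 (by norm_num) (by norm_num), fun z hz => ?_⟩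
      rw [eqs_iff, hd0 z hz]
      simp
    · have hrel : ∀ w ∈ ball (0 : ℂ) 1, b w * (1 - μ * (starRingEnd ℂ) μ) -
          d w * (μ - w * (starRingEnd ℂ) μ) = 0 := by
        refine zero_of_punctured _ (by fun_prop) fun w hw hw0 => ?_
        obtain ⟨z, hz, hz0, rfl⟩ := exists_sqrt w hw hw0
        have hz' : -z ∈ ball (0 : ℂ) 1 := by simpa using hz
        have n1 := one_add_ne μ z hμ hz
        have n2 := one_add_ne μ (-z) hμ hz'
        have q1 := hbm z hz
        have q2 := hdm z hz
        have r1 := hmp z hz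
        have r2 := hmp (-z) hz'
        rw [← hpe z hz] at r2
        rw [eq_div_iff n1] at r1
        rw [eq_div_iff n2] at r2
        apply (mul_eq_zero.1 _).resolve_left (mul_ne_zero hz0 (mul_ne_zero n1 n2))
        generalize (starRingEnd ℂ) μ = ν at *
        generalize m (-z) = y at *
        generalize m z = x at *
        generalize b (z ^ 2) = B at *
        generalize d (z ^ 2) = D at *
        generalize p z = P at *
        subst q1
        have : z * ((x + y) * (1 - μ * ν)) - (x - y) * (μ - z ^ 2 * ν) =
          -x * (μ - z) * (1 + ν * z) + y * (z + μ) * (1 - ν * z) := by ring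
        linear_combination (1 + ν * z) * (1 + ν * -z) * (this - (μ - z ^ 2 * ν) * q2) +
          (-(μ - z) * (1 + ν * z) * (1 + ν * -z)) * r1 +
          ((z + μ) * (1 - ν * z) * (1 + ν * z)) * r2
      have hpos : (1 : ℝ) + Complex.normSq μ ≠ 0 := by
        have := Complex.normSq_nonneg μ
        linarith
      have hN : (1 : ℂ) + Complex.normSq μ ≠ 0 := by exact_mod_cast hpos
      have hmc := Complex.mul_conj μ
      have hP1 := proj_mk (Complex.normSq μ / (1 + Complex.normSq μ)) (1 / (1 + Complex.normSq μ))
        (μ / (1 + Complex.normSq μ)) (by field_simp; ring) (by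
          simp only [map_div₀, map_add, map_one, Complex.conj_ofReal]
          push_cast
          field_simp
          exact hmc.symm)
      have hP2 := proj_mk (1 / (1 + Complex.normSq μ)) (Complex.normSq μ / (1 + Complex.normSq μ))
        (μ / (1 + Complex.normSq μ)) (by field_simp) (by
          simp only [map_div₀, map_add, map_one, Complex.conj_ofReal]
          push_cast
          field_simp
          exact hmc.symm)
      refine ⟨_, _, hP1, hP2, fun z hz => ?_⟩
      rw [eqs_iff]
      have hr := hrel z hz
      rw [hmc] at hr
      simp only [map_div₀, map_add, map_one, Complex.conj_ofReal]
      push_cast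
      refine ⟨?_, ?_, ?_, ?_⟩
      · field_simp
        linear_combination hr
      · field_simp
        ring
      · field_simp
        ring
      · field_simp
        linear_combination -hr
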